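/- arXiv:1503.04142 — 2 statements merged into one kernel-verified Lean document; each statement's English description precedes it below -/
import Mathlib

section
/- Let M be a 4-dimensional vector space over a division ring. For any two apartments 𝒜, 𝒜' of 𝒢_2(M) there is a finite sequence of apartments 𝒜 = 𝒜_1, 𝒜_2, …, 𝒜_j = 𝒜' such that 𝒜_t and 𝒜_{t+1} are adjacent (i.e. |𝒜_t ∩ 𝒜_{t+1}| = 4) for every t ∈ {1,…,j−1}. -/
open Module

/-- The apartment of `𝒢_2(M)` associated to a basis `b` of a `4`-dimensional space:
the six `2`-dimensional subspaces spanned by two distinct basis vectors. -/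
def apartmentOf {D M : Type*} [DivisionRing D] [AddCommGroup M] [Module D M]
    (b : Basis (Fin 4) D M) : Set (Submodule D M) :=
  {X | ∃ j k : Fin 4, j ≠ k ∧ X = Submodule.span D ({b j, b k} : Set M)}

/-- An apartment of `𝒢_2(M)`. -/
def IsApartment {D M : Type*} [DivisionRing D] [AddCommGroup M] [Module D M]
    (𝒜 : Set (Submodule D M)) : Prop :=
  ∃ b : Basis (Fin 4) D M, 𝒜 = apartmentOf b

open Relation

section Apartments

variable {D M : Type*} [DivisionRing D] [AddCommGroup M] [Module D M]

/-- The coordinate subspace of a basis on a finite set of indices. -/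
def coordSpan (b : Basis (Fin 4) D M) (s : Finset (Fin 4)) : Submodule D M :=
  Submodule.span D (b '' s)

/-- Adjacency of apartments. -/
def ApartmentAdj (𝒜 ℬ : Set (Submodule D M)) : Prop :=
  IsApartment 𝒜 ∧ IsApartment ℬ ∧ (𝒜 ∩ ℬ).ncard = 4

lemma apply_mem_coordSpan (b : Basis (Fin 4) D M) {s : Finset (Fin 4)} {i : Fin 4} (hi : i ∈ s) :
    b i ∈ coordSpan b s :=
  Submodule.subset_span ⟨i, hi, rfl⟩

lemma mem_of_apply_mem_coordSpan (b : Basis (Fin 4) D M) {s : Finset (Fin 4)} {i : Fin 4}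
    (hi : b i ∈ coordSpan b s) : i ∈ s := by
  nontriviality D
  have h := (b.mem_span_image (s := (s : Set (Fin 4)))).1 hi
  simpa [Finsupp.support_single] using h

lemma coordSpan_injective (b : Basis (Fin 4) D M) : Function.Injective (coordSpan b) := by
  intro s t h
  ext i
  exact ⟨fun hi => mem_of_apply_mem_coordSpan b (h ▸ apply_mem_coordSpan b hi),
    fun hi => mem_of_apply_mem_coordSpan b (h ▸ apply_mem_coordSpan b hi)⟩

lemma coordSpan_le {b : Basis (Fin 4) D M} {s : Finset (Fin 4)} {N : Submodule D M}
    (h : ∀ i ∈ s, b i ∈ N) : coordSpan b s ≤ N := by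
  rw [coordSpan, Submodule.span_le]
  rintro _ ⟨i, hi, rfl⟩
  exact h i hi

lemma apartmentOf_eq_image (b : Basis (Fin 4) D M) :
    apartmentOf b = coordSpan b '' {s | s.card = 2} := by
  ext X
  constructor
  · rintro ⟨j, k, hjk, rfl⟩
    exact ⟨{j, k}, Finset.card_pair hjk, by simp [coordSpan, Set.image_pair]⟩
  · rintro ⟨s, hs, rfl⟩
    obtain ⟨j, k, hjk, rfl⟩ := Finset.card_eq_two.1 hs
    exact ⟨j, k, hjk, by simp [coordSpan, Set.image_pair]⟩

lemma apartmentOf_reindex (b : Basis (Fin 4) D M) (σ : Equiv.Perm (Fin 4)) :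
    apartmentOf (b.reindex σ) = apartmentOf b := by
  ext X
  constructor
  · rintro ⟨j, k, hjk, rfl⟩
    exact ⟨σ.symm j, σ.symm k, σ.symm.injective.ne hjk, by simp⟩
  · rintro ⟨j, k, hjk, rfl⟩
    exact ⟨σ j, σ k, σ.injective.ne hjk, by simp⟩

lemma exists_basis_smul (b : Basis (Fin 4) D M) (k : Fin 4) {a : D} (ha : a ≠ 0) :
    ∃ b' : Basis (Fin 4) D M, b' k = a • b k ∧ (∀ j ≠ k, b' j = b j) ∧
      apartmentOf b' = apartmentOf b := by
  let w : Fin 4 → D := Function.update 1 k a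
  have hw : ∀ i, w i ≠ 0 := fun i => by
    rcases eq_or_ne i k with rfl | h <;> simp [w, *]
  have hb : ∀ i, b.isUnitSMul (fun i => (hw i).isUnit) i = w i • b i := b.isUnitSMul_apply _
  refine ⟨b.isUnitSMul fun i => (hw i).isUnit, by simp [hb, w], fun j hj => by simp [hb, w, hj], ?_⟩
  have hs : ∀ s, coordSpan (b.isUnitSMul fun i => (hw i).isUnit) s = coordSpan b s := by
    intro s
    apply le_antisymm <;> refine coordSpan_le fun i hi => ?_
    · rw [hb]
      exact Submodule.smul_mem _ _ (apply_mem_coordSpan b hi)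
    · rw [← inv_smul_smul₀ (hw i) (b i), ← hb]
      exact Submodule.smul_mem _ _ (apply_mem_coordSpan _ hi)
  simp [apartmentOf_eq_image, hs]

lemma coordSpan_eq_of_transvection {b b' : Basis (Fin 4) D M} {k i : Fin 4} {a : D}
    (hki : k ≠ i) (hk : b' k = b k + a • b i) (hb : ∀ j ≠ k, b' j = b j) {s : Finset (Fin 4)}
    (hs : k ∈ s → i ∈ s) : coordSpan b' s = coordSpan b s := by
  apply le_antisymm <;> refine coordSpan_le fun j hj => ?_
  · rcases eq_or_ne j k with rfl | h
    · rw [hk]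
      exact add_mem (apply_mem_coordSpan b hj)
        (Submodule.smul_mem _ _ (apply_mem_coordSpan b (hs hj)))
    · rw [hb j h]
      exact apply_mem_coordSpan b hj
  · rcases eq_or_ne j k with rfl | h
    · rw [eq_sub_of_add_eq hk.symm, ← hb i hki.symm]
      exact sub_mem (apply_mem_coordSpan b' hj)
        (Submodule.smul_mem _ _ (apply_mem_coordSpan b' (hs hj)))
    · rw [← hb j h]
      exact apply_mem_coordSpan b' hj

lemma apartmentAdj_of_transvection {b b' : Basis (Fin 4) D M} {k i : Fin 4} {a : D}
    (hki : k ≠ i) (ha : a ≠ 0) (hk : b' k = b k + a • b i) (hb : ∀ j ≠ k, b' j = b j) :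
    ApartmentAdj (apartmentOf b) (apartmentOf b') := by
  have key : apartmentOf b ∩ apartmentOf b' = coordSpan b ''
      (Finset.univ.filter fun s : Finset (Fin 4) => s.card = 2 ∧ (k ∈ s → i ∈ s) :) := by
    rw [apartmentOf_eq_image, apartmentOf_eq_image]
    apply Set.Subset.antisymm
    · rintro _ ⟨⟨s, hs, rfl⟩, s', hs', h⟩
      refine ⟨s, ?_, rfl⟩
      simp only [Finset.coe_filter, Finset.mem_univ, true_and, Set.mem_ofPred_eq]
      refine ⟨hs, fun hks => ?_⟩
      by_cases hc : k ∈ s' → i ∈ s'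
      · rw [coordSpan_eq_of_transvection hki hk hb hc] at h
        rw [coordSpan_injective b h] at hc
        exact hc hks
      · push Not at hc
        have h1 : b' k ∈ coordSpan b s := h ▸ apply_mem_coordSpan b' hc.1
        rw [hk, Submodule.add_mem_iff_right _ (apply_mem_coordSpan b hks),
          Submodule.smul_mem_iff _ ha] at h1
        exact mem_of_apply_mem_coordSpan b h1
    · rintro _ ⟨s, hs, rfl⟩
      simp only [Finset.coe_filter, Finset.mem_univ, true_and, Set.mem_ofPred_eq] at hs
      exact ⟨⟨s, hs.1, rfl⟩, s, hs.1, coordSpan_eq_of_transvection hki hk hb hs.2⟩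
  refine ⟨⟨b, rfl⟩, ⟨b', rfl⟩, ?_⟩
  rw [key, Set.ncard_image_of_injective _ (coordSpan_injective b), Set.ncard_coe_finset]
  clear key hk hb
  revert k i
  decide

lemma exists_basis_transvection [FiniteDimensional D M] (hM : finrank D M = 4)
    (b : Basis (Fin 4) D M) {k i : Fin 4} (hki : k ≠ i) (a : D) :
    ∃ b' : Basis (Fin 4) D M, b' k = b k + a • b i ∧ (∀ j ≠ k, b' j = b j) ∧
      ReflTransGen ApartmentAdj (apartmentOf b) (apartmentOf b') := by
  rcases eq_or_ne a 0 with rfl | ha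
  · exact ⟨b, by simp, fun _ _ => rfl, .refl⟩
  have h := (linearIndependent_add_smul_iff (v := b) (c := Pi.single k a) (i := i)
    (by simp [hki.symm])).2 b.linearIndependent
  let b' := basisOfLinearIndependentOfCardEqFinrank h (by simp [hM])
  have hk : b' k = b k + a • b i := by simp [b']
  have hb : ∀ j ≠ k, b' j = b j := fun j hj => by simp [b', hj]
  exact ⟨b', hk, hb, .single (apartmentAdj_of_transvection hki ha hk hb)⟩

lemma exists_basis_add_sum [FiniteDimensional D M] (hM : finrank D M = 4)
    (b : Basis (Fin 4) D M) {k : Fin 4} (c : Fin 4 → D) (s : Finset (Fin 4)) (hk : k ∉ s) :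
    ∃ b' : Basis (Fin 4) D M, b' k = b k + ∑ i ∈ s, c i • b i ∧ (∀ j ≠ k, b' j = b j) ∧
      ReflTransGen ApartmentAdj (apartmentOf b) (apartmentOf b') := by
  induction s using Finset.induction_on with
  | empty => exact ⟨b, by simp, fun _ _ => rfl, .refl⟩
  | insert i s hi ih =>
    rw [Finset.mem_insert, not_or] at hk
    obtain ⟨b₁, h₁, hb₁, hc₁⟩ := ih hk.2
    obtain ⟨b₂, h₂, hb₂, hc₂⟩ := exists_basis_transvection hM b₁ hk.1 (c i)
    refine ⟨b₂, ?_, fun j hj => (hb₂ j hj).trans (hb₁ j hj), hc₁.trans hc₂⟩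
    rw [h₂, h₁, hb₁ i (Ne.symm hk.1), Finset.sum_insert hi]
    abel

lemma exists_basis_replace [FiniteDimensional D M] (hM : finrank D M = 4)
    (b : Basis (Fin 4) D M) {k : Fin 4} {v : M} (hv : b.repr v k ≠ 0) :
    ∃ b' : Basis (Fin 4) D M, b' k = v ∧ (∀ j ≠ k, b' j = b j) ∧
      ReflTransGen ApartmentAdj (apartmentOf b) (apartmentOf b') := by
  obtain ⟨b₁, h₁, hb₁, hc₁⟩ := exists_basis_smul b k hv
  obtain ⟨b₂, h₂, hb₂, hc₂⟩ := exists_basis_add_sum hM b₁ (b.repr v) (Finset.univ.erase k)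
    (Finset.notMem_erase k _)
  refine ⟨b₂, ?_, fun j hj => (hb₂ j hj).trans (hb₁ j hj), hc₁ ▸ hc₂⟩
  rw [h₂, h₁, Finset.sum_congr rfl fun i hi => by rw [hb₁ i (Finset.ne_of_mem_erase hi)],
    Finset.add_sum_erase _ (fun i => b.repr v i • b i) (Finset.mem_univ k), b.sum_repr]

lemma exists_basis_eqOn [FiniteDimensional D M] (hM : finrank D M = 4)
    (b b' : Basis (Fin 4) D M) (s : Finset (Fin 4)) :
    ∃ b₁ : Basis (Fin 4) D M, (∀ i ∈ s, b₁ i = b' i) ∧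
      ReflTransGen ApartmentAdj (apartmentOf b) (apartmentOf b₁) := by
  induction s using Finset.induction_on with
  | empty => exact ⟨b, by simp, .refl⟩
  | insert k s hk ih =>
    obtain ⟨b₁, h₁, hc₁⟩ := ih
    obtain ⟨j, hjs, hj⟩ : ∃ j, j ∉ s ∧ b₁.repr (b' k) j ≠ 0 := by
      by_contra! h
      apply hk
      apply mem_of_apply_mem_coordSpan b'
      rw [← b₁.sum_repr (b' k)]
      refine Submodule.sum_mem _ fun i _ => ?_
      by_cases hi : i ∈ s
      · rw [h₁ i hi]
        exact Submodule.smul_mem _ _ (apply_mem_coordSpan b' hi)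
      · simp [h i hi]
    obtain ⟨b₂, h₂, hb₂, hc₂⟩ := exists_basis_replace hM (b₁.reindex (Equiv.swap j k))
      (k := k) (v := b' k) (by simpa using hj)
    rw [apartmentOf_reindex] at hc₂
    refine ⟨b₂, fun i hi => ?_, hc₁.trans hc₂⟩
    rcases Finset.mem_insert.1 hi with rfl | hi
    · exact h₂
    · have hik : i ≠ k := fun h => hk (h ▸ hi)
      have hij : i ≠ j := fun h => hjs (h ▸ hi)
      rw [hb₂ i hik, Basis.reindex_apply, Equiv.symm_swap, Equiv.swap_apply_of_ne_of_ne hij hik,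
        h₁ i hi]

end Apartments

lemma Relation.ReflTransGen.exists_nat_chain {α : Type*} {r : α → α → Prop} {a b : α}
    (h : ReflTransGen r a b) :
    ∃ (n : ℕ) (f : ℕ → α), f 0 = a ∧ f n = b ∧ ∀ t < n, r (f t) (f (t + 1)) := by
  induction h using ReflTransGen.head_induction_on with
  | refl => exact ⟨0, fun _ => b, rfl, rfl, by simp⟩
  | @head a c hac _ ih =>
    obtain ⟨n, f, h0, hn, hf⟩ := ih
    refine ⟨n + 1, fun t => Nat.casesOn t a f, rfl, hn, fun t ht => ?_⟩
    cases t with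
    | zero => simpa [h0] using hac
    | succ t => exact hf t (Nat.lt_of_succ_lt_succ ht)

/-- Any two apartments of `𝒢_2(M)`, `M` a `4`-dimensional vector
space over a division ring, are connected by a sequence of apartments in which
consecutive members are adjacent (intersect in precisely `4` elements). -/
theorem stmt10 {D M : Type*} [DivisionRing D] [AddCommGroup M] [Module D M]
    [FiniteDimensional D M] (hM : Module.finrank D M = 4)
    (𝒜 𝒜' : Set (Submodule D M)) (h𝒜 : IsApartment 𝒜) (h𝒜' : IsApartment 𝒜') :
    ∃ j : ℕ, ∃ c : Fin (j + 1) → Set (Submodule D M),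
      c 0 = 𝒜 ∧ c (Fin.last j) = 𝒜' ∧ (∀ t, IsApartment (c t)) ∧
      ∀ t : Fin j, (c t.castSucc ∩ c t.succ).ncard = 4 := by
  obtain ⟨b, rfl⟩ := h𝒜
  obtain ⟨b', rfl⟩ := h𝒜'
  obtain ⟨b₁, h₁, hc⟩ := exists_basis_eqOn hM b b' Finset.univ
  obtain rfl : b₁ = b' := Basis.eq_of_apply_eq fun i => h₁ i (Finset.mem_univ i)
  obtain ⟨n, f, h0, hn, hf⟩ := hc.exists_nat_chain
  refine ⟨n, fun t => f t, h0, hn, fun t => ?_, fun t => (hf t t.isLt).2.2⟩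
  rcases (Nat.lt_succ_iff.1 t.isLt).lt_or_eq with ht | ht
  · exact (hf t ht).1
  · exact ⟨b₁, (congrArg f ht).trans hn⟩
end

section
/- Let M be a 4-dimensional vector space over a division ring. For any two 2-dimensional subspaces A and B of M there exists a basis e_1, e_2, e_3, e_4 of M such that both A and B are spanned by two of the basis vectors; that is, any two elements of 𝒢_2(M) are contained in a common apartment of 𝒢_2(M). -/
open Module

/-- An independent subset of a subspace extends to a finite independent set spanning it. -/
theorem exists_linearIndepOn_span_eq {D M : Type*} [DivisionRing D] [AddCommGroup M]
    [Module D M] [FiniteDimensional D M] {s : Set M} (W : Submodule D M)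
    (hs : LinearIndepOn D id s) (hsW : s ⊆ W) :
    ∃ t : Set M, s ⊆ t ∧ LinearIndepOn D id t ∧ Submodule.span D t = W ∧ t.Finite ∧
      t.ncard = finrank D W := by
  obtain ⟨t, htW, hst, hWt, ht⟩ := exists_linearIndepOn_id_extension hs hsW
  have hspan : Submodule.span D t = W := le_antisymm (Submodule.span_le.2 htW) hWt
  have hfin : t.Finite := LinearIndependent.setFinite ht
  have := hfin.fintype
  refine ⟨t, hst, ht, hspan, hfin, ?_⟩
  rw [← hspan, finrank_span_set_eq_card ht, Set.ncard_eq_toFinset_card']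

/-- Any two subspaces are spanned by subsets of a common independent set. -/
theorem exists_linearIndepOn_span_eq_span_eq {D M : Type*} [DivisionRing D] [AddCommGroup M]
    [Module D M] [FiniteDimensional D M] (A B : Submodule D M) :
    ∃ s t : Set M, LinearIndepOn D id (s ∪ t) ∧
      (Submodule.span D s = A ∧ s.ncard = finrank D A) ∧
      (Submodule.span D t = B ∧ t.ncard = finrank D B) := by
  obtain ⟨r, -, hr, hrspan, -, hrcard⟩ :=
    exists_linearIndepOn_span_eq (A ⊓ B) (linearIndepOn_empty D id) (Set.empty_subset _)
  have hrAB : r ⊆ (A ⊓ B : Submodule D M) := hrspan ▸ Submodule.subset_span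
  obtain ⟨s, hrs, hs, hsspan, hsfin, hscard⟩ :=
    exists_linearIndepOn_span_eq A hr fun x hx => (hrAB hx).1
  obtain ⟨t, hrt, ht, htspan, htfin, htcard⟩ :=
    exists_linearIndepOn_span_eq B hr fun x hx => (hrAB hx).2
  refine ⟨s, t, ?_, ⟨hsspan, hscard⟩, htspan, htcard⟩
  have := (hsfin.union htfin).fintype
  have hrst := Set.ncard_le_ncard (Set.subset_inter hrs hrt) (hsfin.inter_of_left t)
  have hunion := Set.ncard_union_add_ncard_inter s t hsfin htfin
  have hsup := Submodule.finrank_sup_add_finrank_inf_eq A B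
  have hle : (s ∪ t).ncard ≤ finrank D (Submodule.span D (s ∪ t)) := by
    rw [Submodule.span_union, hsspan, htspan]
    omega
  refine linearIndependent_iff_card_le_finrank_span.2 ?_
  rw [Set.ncard_eq_toFinset_card', Set.toFinset_card] at hle
  rwa [Set.finrank, show Set.range (fun x : ↥(s ∪ t) => id (x : M)) = s ∪ t from Subtype.range_coe]

/-- A two-element subset of the range of a family consists of two of its members. -/
theorem exists_ne_eq_pair_of_subset_range {ι α : Type*} {f : ι → α} {s : Set α}
    (hs : s ⊆ Set.range f) (hcard : s.ncard = 2) : ∃ j k, j ≠ k ∧ s = {f j, f k} := by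
  obtain ⟨x, y, hxy, rfl⟩ := Set.ncard_eq_two.1 hcard
  obtain ⟨j, rfl⟩ := hs (Set.mem_insert x _)
  obtain ⟨k, rfl⟩ := hs (Set.mem_insert_of_mem _ rfl)
  exact ⟨j, k, fun h => hxy (congrArg f h), rfl⟩

/-- In a `4`-dimensional vector space `M` over a division ring,
any two `2`-dimensional subspaces `A`, `B` are contained in a common apartment of
`𝒢_2(M)`: there is a basis `e₁, e₂, e₃, e₄` of `M` such that both `A` and `B` are
spanned by two of the basis vectors. -/
theorem stmt19 {D M : Type*} [DivisionRing D] [AddCommGroup M] [Module D M]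
    [FiniteDimensional D M] (hM : Module.finrank D M = 4)
    (A B : Submodule D M)
    (hA : Module.finrank D ↥A = 2) (hB : Module.finrank D ↥B = 2) :
    ∃ b : Basis (Fin 4) D M,
      (∃ j k : Fin 4, j ≠ k ∧ A = Submodule.span D ({b j, b k} : Set M)) ∧
      (∃ j k : Fin 4, j ≠ k ∧ B = Submodule.span D ({b j, b k} : Set M)) := by
  obtain ⟨s, t, hst, ⟨rfl, hs⟩, rfl, ht⟩ := exists_linearIndepOn_span_eq_span_eq A B
  let c := Basis.extend hst
  have := FiniteDimensional.fintypeBasisIndex c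
  let b := c.reindex (Fintype.equivFinOfCardEq ((finrank_eq_card_basis c).symm.trans hM))
  have hb : s ∪ t ⊆ Set.range b := by
    rw [Basis.range_reindex, Basis.range_extend]
    exact Basis.subset_extend hst
  obtain ⟨j, k, hjk, hsb⟩ :=
    exists_ne_eq_pair_of_subset_range (Set.subset_union_left.trans hb) (hs.trans hA)
  obtain ⟨l, m, hlm, htb⟩ :=
    exists_ne_eq_pair_of_subset_range (Set.subset_union_right.trans hb) (ht.trans hB)
  exact ⟨b, ⟨j, k, hjk, by rw [← hsb]⟩, l, m, hlm, by rw [← htb]⟩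
end
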